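/- arXiv:2405.11701 — 2 statements merged into one kernel-verified Lean document; each statement's English description precedes it below -/
import Mathlib

section
/- Let λ ∈ (0,1) and x ∈ (0,∞). Then ((1-λ) + λ·x⁻¹)⁻¹ ≤ (∫₀¹ ((1-t)+tx)⁻¹ dη_λ(t))⁻¹ ≤ (1-λ) + λx; that is, the λ-weighted harmonic mean of 1 and x is below f_λ(x), which is below the λ-weighted arithmetic mean of 1 and x. -/
open Set intervalIntegral

/-- The weight `l / (1 - l) * t ^ ((2 * l - 1) / (1 - l))` is integrable on `[0, 1]`. -/
theorem intervalIntegrable_logMeanWeight {l : ℝ} (hl : l ∈ Ioo (0 : ℝ) 1) :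
    IntervalIntegrable (fun t : ℝ => l / (1 - l) * t ^ ((2 * l - 1) / (1 - l)))
      MeasureTheory.volume 0 1 := by
  have h1 : 0 < 1 - l := sub_pos.2 hl.2
  refine (intervalIntegrable_rpow' ?_).const_mul _
  rw [lt_div_iff₀ h1]
  linarith [hl.1]

theorem logMeanWeight_nonneg {l t : ℝ} (hl : l ∈ Ioo (0 : ℝ) 1) (ht : 0 ≤ t) :
    0 ≤ l / (1 - l) * t ^ ((2 * l - 1) / (1 - l)) :=
  mul_nonneg (div_nonneg hl.1.le (sub_pos.2 hl.2).le) (Real.rpow_nonneg ht _)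

/-- The weight has total mass `1` and barycentre `l`. -/
theorem integral_affine_mul_logMeanWeight {l : ℝ} (hl : l ∈ Ioo (0 : ℝ) 1) (c d : ℝ) :
    ∫ t in (0 : ℝ)..1, (c + d * t) * (l / (1 - l) * t ^ ((2 * l - 1) / (1 - l))) =
      c + d * l := by
  have h0 : 0 < l := hl.1
  have h1 : 0 < 1 - l := sub_pos.2 hl.2
  set p := (2 * l - 1) / (1 - l) with hp
  have hp1 : p + 1 = l / (1 - l) := by rw [hp]; field_simp; ring
  have hp2 : p + 1 + 1 = 1 / (1 - l) := by rw [hp]; field_simp; ring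
  have hp0 : 0 < p + 1 := hp1 ▸ div_pos h0 h1
  have hsplit : EqOn (fun t : ℝ => (c + d * t) * (l / (1 - l) * t ^ p))
      (fun t => c * (l / (1 - l)) * t ^ p + d * (l / (1 - l)) * t ^ (p + 1)) (uIcc 0 1) := by
    intro t ht
    rw [uIcc_of_le zero_le_one] at ht
    simp only [Real.rpow_add_one' ht.1 hp0.ne']
    ring
  rw [integral_congr hsplit, integral_add
    ((intervalIntegrable_rpow' (by linarith)).const_mul _)
    ((intervalIntegrable_rpow' (by linarith)).const_mul _),
    integral_const_mul, integral_const_mul, integral_rpow (Or.inl (by linarith)),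
    integral_rpow (Or.inl (by linarith)), Real.one_rpow, Real.one_rpow,
    Real.zero_rpow hp0.ne', Real.zero_rpow (by linarith), hp2, hp1]
  field_simp
  ring

theorem segment_one_pos {t x : ℝ} (ht : t ∈ Icc (0 : ℝ) 1) (hx : 0 < x) :
    0 < (1 - t) + t * x := by
  rcases ht.1.eq_or_lt with rfl | h
  · norm_num
  · linarith [ht.2, mul_pos h hx]

theorem inv_segment_le {t x : ℝ} (ht : t ∈ Icc (0 : ℝ) 1) (hx : 0 < x) :
    ((1 - t) + t * x)⁻¹ ≤ 1 + (x⁻¹ - 1) * t := by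
  have hy := segment_one_pos ht hx
  rw [inv_le_iff_one_le_mul₀ hy]
  have h : (1 + (x⁻¹ - 1) * t) * ((1 - t) + t * x) = 1 + t * (1 - t) * ((x - 1) ^ 2 * x⁻¹) := by
    field_simp
    ring
  rw [h]
  have := mul_nonneg (mul_nonneg ht.1 (sub_nonneg.2 ht.2))
    (mul_nonneg (sq_nonneg (x - 1)) (inv_pos.2 hx).le)
  linarith

/-- The tangent line of `y ↦ y⁻¹` at `m` lies below its graph. -/
theorem tangent_le_inv {m y : ℝ} (hm : 0 < m) (hy : 0 < y) :
    2 * m⁻¹ - y * m⁻¹ ^ 2 ≤ y⁻¹ := by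
  have h : y⁻¹ - (2 * m⁻¹ - y * m⁻¹ ^ 2) = y⁻¹ * (1 - y * m⁻¹) ^ 2 := by
    field_simp
    ring
  have := mul_nonneg (inv_pos.2 hy).le (sq_nonneg (1 - y * m⁻¹))
  linarith


/-- Scalar form of `A!_λB ≤ L_λ(A,B) ≤ A∇_λB`:
the λ-weighted harmonic mean of `1` and `x` is below `f_λ(x)`, which is below
the λ-weighted arithmetic mean of `1` and `x`. -/
theorem stmt_16 (l : ℝ) (hl : l ∈ Set.Ioo (0 : ℝ) 1) (x : ℝ) (hx : 0 < x) :
    ((1 - l) + l * x⁻¹)⁻¹ ≤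
      (∫ t in (0 : ℝ)..1, ((1 - t) + t * x)⁻¹ *
        (l / (1 - l) * t ^ ((2 * l - 1) / (1 - l))))⁻¹ ∧
    (∫ t in (0 : ℝ)..1, ((1 - t) + t * x)⁻¹ *
        (l / (1 - l) * t ^ ((2 * l - 1) / (1 - l))))⁻¹ ≤
      (1 - l) + l * x := by
  have hg : IntervalIntegrable (fun t : ℝ => ((1 - t) + t * x)⁻¹ *
      (l / (1 - l) * t ^ ((2 * l - 1) / (1 - l)))) MeasureTheory.volume 0 1 := by
    refine (intervalIntegrable_logMeanWeight hl).continuousOn_mul ?_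
    refine ContinuousOn.inv₀ (by fun_prop) fun t ht => ?_
    rw [uIcc_of_le zero_le_one] at ht
    exact (segment_one_pos ht hx).ne'
  have haff (c d : ℝ) : IntervalIntegrable (fun t : ℝ => (c + d * t) *
      (l / (1 - l) * t ^ ((2 * l - 1) / (1 - l)))) MeasureTheory.volume 0 1 :=
    (intervalIntegrable_logMeanWeight hl).continuousOn_mul (by fun_prop)
  have hm := segment_one_pos ⟨hl.1.le, hl.2.le⟩ hx
  set m := (1 - l) + l * x with hmdef
  have hlower : m⁻¹ ≤ ∫ t in (0 : ℝ)..1, ((1 - t) + t * x)⁻¹ *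
      (l / (1 - l) * t ^ ((2 * l - 1) / (1 - l))) := by
    have h := integral_mono_on zero_le_one
      (haff (2 * m⁻¹ - m⁻¹ ^ 2) ((1 - x) * m⁻¹ ^ 2)) hg fun t ht =>
      mul_le_mul_of_nonneg_right
        (le_trans (le_of_eq (by ring)) (tangent_le_inv hm (segment_one_pos ht hx)))
        (logMeanWeight_nonneg hl ht.1)
    rw [integral_affine_mul_logMeanWeight hl] at h
    refine le_trans (le_of_eq ?_) h
    have : m⁻¹ ^ 2 * m = m⁻¹ := by field_simp
    linear_combination this - m⁻¹ ^ 2 * hmdef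
  have hupper : ∫ t in (0 : ℝ)..1, ((1 - t) + t * x)⁻¹ *
      (l / (1 - l) * t ^ ((2 * l - 1) / (1 - l))) ≤ (1 - l) + l * x⁻¹ := by
    have h := integral_mono_on zero_le_one hg (haff 1 (x⁻¹ - 1)) fun t ht =>
      mul_le_mul_of_nonneg_right (inv_segment_le ht hx) (logMeanWeight_nonneg hl ht.1)
    rw [integral_affine_mul_logMeanWeight hl] at h
    linarith
  have hpos := (inv_pos.2 hm).trans_le hlower
  exact ⟨inv_anti₀ hpos hupper, inv_le_of_inv_le₀ hm hlower⟩
end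

section
/- Let λ ∈ (0,1) and x ∈ (0,∞). Then x^λ ≤ ∫₀¹ x^t dη_λ(t) ≤ (1-λ) + λx; that is, the λ-weighted geometric mean of 1 and x is below g_λ(x), which is below the λ-weighted arithmetic mean of 1 and x. -/
/-- The measure with density `t ↦ c * t ^ p` on `[0, 1]`, where `c = l / (1 - l)` and
`p = (2 * l - 1) / (1 - l)`, is a probability measure with mean `l`. -/
theorem integral_affine_mul_weight {l : ℝ} (hl : l ∈ Set.Ioo (0 : ℝ) 1) (a b : ℝ) :
    (∫ t in (0 : ℝ)..1, (a + b * t) * (l / (1 - l) * t ^ ((2 * l - 1) / (1 - l)))) =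
      a + b * l := by
  obtain ⟨h0, h1⟩ := hl
  have h1' : 0 < 1 - l := sub_pos.2 h1
  have hp : (2 * l - 1) / (1 - l) = l / (1 - l) - 1 := by field_simp; ring
  have hc : 0 < l / (1 - l) := div_pos h0 h1'
  have hcl : l / (1 - l) = l * (l / (1 - l) + 1) := by field_simp; ring
  rw [hp]
  generalize l / (1 - l) = c at hc hcl
  have hrw : ∀ t ∈ Set.uIcc (0 : ℝ) 1,
      (a + b * t) * (c * t ^ (c - 1)) = a * c * t ^ (c - 1) + b * c * t ^ c := by
    intro t ht
    rw [Set.uIcc_of_le zero_le_one] at ht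
    have hmul : t ^ c = t ^ (c - 1) * t := by
      have := Real.rpow_add_one' ht.1 (y := c - 1) (by linarith)
      rwa [sub_add_cancel] at this
    rw [hmul]
    ring
  rw [intervalIntegral.integral_congr hrw, intervalIntegral.integral_add
    ((intervalIntegral.intervalIntegrable_rpow' (by linarith)).const_mul _)
    ((intervalIntegral.intervalIntegrable_rpow' (by linarith)).const_mul _),
    intervalIntegral.integral_const_mul, intervalIntegral.integral_const_mul,
    integral_rpow (Or.inl (by linarith)), integral_rpow (Or.inl (by linarith)),
    sub_add_cancel, Real.one_rpow, Real.one_rpow, Real.zero_rpow hc.ne',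
    Real.zero_rpow (by linarith)]
  have hl' : l = c / (c + 1) := by rw [eq_div_iff (by linarith)]; exact hcl.symm
  rw [hl']
  field_simp
  ring

theorem intervalIntegrable_continuous_mul_weight {l : ℝ} (hl : l ∈ Set.Ioo (0 : ℝ) 1)
    {f : ℝ → ℝ} (hf : Continuous f) :
    IntervalIntegrable (fun t ↦ f t * (l / (1 - l) * t ^ ((2 * l - 1) / (1 - l))))
      MeasureTheory.volume 0 1 := by
  have h1 : 0 < 1 - l := sub_pos.2 hl.2
  have hp : -1 < (2 * l - 1) / (1 - l) := by
    rw [lt_div_iff₀ h1]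
    linarith [hl.1]
  exact ((intervalIntegral.intervalIntegrable_rpow' hp).const_mul _).continuousOn_mul
    hf.continuousOn

/-- Integration against the weight is monotone. -/
theorem integral_mul_weight_mono {l : ℝ} (hl : l ∈ Set.Ioo (0 : ℝ) 1) {f g : ℝ → ℝ}
    (hf : Continuous f) (hg : Continuous g) (hfg : ∀ t ∈ Set.Icc (0 : ℝ) 1, f t ≤ g t) :
    (∫ t in (0 : ℝ)..1, f t * (l / (1 - l) * t ^ ((2 * l - 1) / (1 - l)))) ≤
      ∫ t in (0 : ℝ)..1, g t * (l / (1 - l) * t ^ ((2 * l - 1) / (1 - l))) :=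
  intervalIntegral.integral_mono_on zero_le_one
    (intervalIntegrable_continuous_mul_weight hl hf)
    (intervalIntegrable_continuous_mul_weight hl hg) fun t ht ↦
      mul_le_mul_of_nonneg_right (hfg t ht) <|
        mul_nonneg (div_nonneg hl.1.le (sub_nonneg.2 hl.2.le)) (Real.rpow_nonneg ht.1 _)

/-- The graph of `t ↦ x ^ t` lies above its tangent at `l`. -/
theorem tangent_le_rpow {x : ℝ} (hx : 0 < x) (l t : ℝ) :
    x ^ l * (1 - l * Real.log x) + x ^ l * Real.log x * t ≤ x ^ t := by
  have h := mul_le_mul_of_nonneg_left (Real.add_one_le_exp (Real.log x * (t - l)))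
    (Real.rpow_pos_of_pos hx l).le
  rw [← Real.rpow_def_of_pos hx, ← Real.rpow_add hx, add_sub_cancel] at h
  linarith

/-- The graph of `t ↦ x ^ t` lies below its chord on `[0, 1]`. -/
theorem rpow_le_chord {x t : ℝ} (hx : 0 ≤ x) (ht : t ∈ Set.Icc (0 : ℝ) 1) :
    x ^ t ≤ 1 + (x - 1) * t := by
  have h := Real.geom_mean_le_arith_mean2_weighted (sub_nonneg.2 ht.2) ht.1 zero_le_one hx
    (sub_add_cancel 1 t)
  rw [Real.one_rpow] at h
  linarith

/-- Scalar form of `A♯_λB ≤ 𝕃_λ(A,B) ≤ A∇_λB`: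
`x^λ ≤ ∫₀¹ x^t dη_λ(t) ≤ (1-λ) + λx`. -/
theorem stmt_17 (l : ℝ) (hl : l ∈ Set.Ioo (0 : ℝ) 1) (x : ℝ) (hx : 0 < x) :
    x ^ l ≤ (∫ t in (0 : ℝ)..1, x ^ t * (l / (1 - l) * t ^ ((2 * l - 1) / (1 - l)))) ∧
    (∫ t in (0 : ℝ)..1, x ^ t * (l / (1 - l) * t ^ ((2 * l - 1) / (1 - l)))) ≤
      (1 - l) + l * x := by
  have hcont : Continuous fun t : ℝ ↦ x ^ t := Real.continuous_const_rpow hx.ne'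
  constructor
  · have h := integral_mul_weight_mono hl (by fun_prop) hcont
      fun t _ ↦ tangent_le_rpow hx l t
    rw [integral_affine_mul_weight hl] at h
    linarith
  · have h := integral_mul_weight_mono hl hcont (by fun_prop)
      fun t ht ↦ rpow_le_chord hx.le ht
    rw [integral_affine_mul_weight hl] at h
    linarith
end
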